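/- Let ε > 0 and c₀ > 0 be fixed. There is a constant C (depending only on ε and c₀) such that for all U, V ≥ 1 and all q ∈ ℤ_{≥1} with q ≤ c₀·U^{1/2} and U ≤ c₀·V^{2/3}, one has ℳ(U,V,q) ≤ C·V^ε·UV/q⁴. -/

import Mathlib

/-- `ℳ(U, V, q)`: the number of `(u, v) ∈ ℤ²` with `v² ≡ u³ (mod q⁴)`, `|u| ≤ U`, `|v| ≤ V` and
`gcd(uv, q) = 1`. -/
noncomputable def Mcount (U V : ℝ) (q : ℤ) : ℕ :=
  Nat.card {t : ℤ × ℤ // t.2 ^ 2 ≡ t.1 ^ 3 [ZMOD q ^ 4] ∧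
    (|t.1| : ℝ) ≤ U ∧ (|t.2| : ℝ) ≤ V ∧ Int.gcd (t.1 * t.2) q = 1}

theorem card_divisors_le_mul_rpow {ε : ℝ} (hε : 0 < ε) :
    ∃ C : ℝ, 0 < C ∧ ∀ n : ℕ, n ≠ 0 → (n.divisors.card : ℝ) ≤ C * (n : ℝ) ^ ε := by
  set K : ℝ := max 1 (1 / (ε * Real.log 2)) with hK
  have hK1 : 1 ≤ K := le_max_left _ _
  have hlog : 0 < ε * Real.log 2 := mul_pos hε (Real.log_pos one_lt_two)
  obtain ⟨P, hP⟩ := exists_nat_gt ((2 : ℝ) ^ (1 / ε))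
  have small (p : ℕ) (hp : 2 ≤ p) (e : ℕ) : ((e : ℝ) + 1) ≤ K * ((p : ℝ) ^ e) ^ ε := by
    have h2 : (1 : ℝ) + ε * Real.log 2 * e ≤ ((p : ℝ) ^ e) ^ ε := by
      calc (1 : ℝ) + ε * Real.log 2 * e ≤ Real.exp (ε * Real.log 2 * e) := by
            linarith [Real.add_one_le_exp (ε * Real.log 2 * e)]
        _ = ((2 : ℝ) ^ e) ^ ε := by
            rw [← Real.rpow_natCast, ← Real.rpow_mul zero_le_two, Real.rpow_def_of_pos two_pos]
            ring_nf
        _ ≤ ((p : ℝ) ^ e) ^ ε := by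
            have : (2 : ℝ) ≤ p := by exact_mod_cast hp
            gcongr
    have h3 : 1 ≤ K * (ε * Real.log 2) := by
      rw [← div_le_iff₀ hlog]; exact le_max_right _ _
    have he : (0 : ℝ) ≤ e := e.cast_nonneg
    nlinarith [mul_le_mul_of_nonneg_left h2 (zero_le_one.trans hK1),
      mul_le_mul_of_nonneg_right h3 he]
  have large (p : ℕ) (hp : P ≤ p) (e : ℕ) : ((e : ℝ) + 1) ≤ ((p : ℝ) ^ e) ^ ε := by
    have h2 : (2 : ℝ) ≤ (p : ℝ) ^ ε := by
      have h4 : (2 : ℝ) ^ (1 / ε) ≤ p := hP.le.trans (by exact_mod_cast hp)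
      calc (2 : ℝ) = ((2 : ℝ) ^ (1 / ε)) ^ ε := by
            rw [← Real.rpow_mul zero_le_two, one_div_mul_cancel hε.ne', Real.rpow_one]
        _ ≤ (p : ℝ) ^ ε := by gcongr
    calc ((e : ℝ) + 1) ≤ 2 ^ e := by exact_mod_cast e.lt_two_pow_self
      _ ≤ ((p : ℝ) ^ ε) ^ e := by gcongr
      _ = ((p : ℝ) ^ e) ^ ε := by
        rw [← Real.rpow_natCast, ← Real.rpow_natCast, ← Real.rpow_mul p.cast_nonneg,
          ← Real.rpow_mul p.cast_nonneg, mul_comm]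
  refine ⟨K ^ P, by positivity, fun n hn ↦ ?_⟩
  have hn' : ((n : ℝ)) ^ ε = ∏ p ∈ n.primeFactors, ((p : ℝ) ^ n.factorization p) ^ ε := by
    rw [Real.finsetProd_rpow _ _ fun p _ ↦ by positivity]
    conv_lhs => rw [← Nat.prod_factorization_pow_eq_self hn]
    simp [Finsupp.prod]
  calc (n.divisors.card : ℝ) = ∏ p ∈ n.primeFactors, ((n.factorization p : ℝ) + 1) := by
        rw [Nat.card_divisors hn]; push_cast; rfl
    _ ≤ ∏ p ∈ n.primeFactors,
        ((if p < P then K else 1) * ((p : ℝ) ^ n.factorization p) ^ ε) := by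
        refine Finset.prod_le_prod (fun _ _ ↦ by positivity) fun p hp ↦ ?_
        split_ifs with h
        · exact small p (Nat.prime_of_mem_primeFactors hp).two_le _
        · simpa using large p (not_lt.1 h) (n.factorization p)
    _ = K ^ (n.primeFactors.filter (· < P)).card * (n : ℝ) ^ ε := by
        rw [Finset.prod_mul_distrib, hn', Finset.prod_ite]; simp
    _ ≤ K ^ P * (n : ℝ) ^ ε := by
        gcongr
        calc _ ≤ (Finset.range P).card := Finset.card_le_card fun p hp ↦ by
                simpa using (Finset.mem_filter.1 hp).2
          _ = P := Finset.card_range P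

theorem sum_Icc_inv_abs_add_one (n : ℕ) :
    ∑ k ∈ Finset.Icc (-(n : ℤ)) n, (1 : ℝ) / (|(k : ℝ)| + 1) ≤ 2 * (harmonic (n + 1) : ℝ) := by
  induction n with
  | zero => simp [harmonic]
  | succ n ih =>
    have h : Finset.Icc (-((n + 1 : ℕ) : ℤ)) (n + 1 : ℕ) =
        insert (-((n + 1 : ℕ) : ℤ)) (insert ((n + 1 : ℕ) : ℤ) (Finset.Icc (-(n : ℤ)) n)) := by
      ext x; simp only [Finset.mem_Icc, Finset.mem_insert]; omega
    rw [h, Finset.sum_insert (by simp only [Finset.mem_Icc, Finset.mem_insert]; omega),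
      Finset.sum_insert (by simp only [Finset.mem_Icc]; omega), harmonic_succ]
    have h1 : |(n : ℝ) + 1| = n + 1 := abs_of_nonneg (by positivity)
    have h2 : |-1 + -(n : ℝ)| = n + 1 := by rw [← neg_add, abs_neg, add_comm]; exact h1
    push_cast
    simp only [neg_add_rev, h1, h2, one_div] at ih ⊢
    linarith

theorem sum_Icc_inv_abs_add_one_le_mul_rpow {ε : ℝ} (hε : 0 < ε) :
    ∃ C : ℝ, 0 < C ∧ ∀ n : ℕ, 1 ≤ n →
      ∑ k ∈ Finset.Icc (-(n : ℤ)) n, (1 : ℝ) / (|(k : ℝ)| + 1) ≤ C * (n : ℝ) ^ ε := by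
  refine ⟨2 * (1 + 2 ^ ε / ε), by positivity, fun n hn ↦ (sum_Icc_inv_abs_add_one n).trans ?_⟩
  have hn' : (1 : ℝ) ≤ n := by exact_mod_cast hn
  have h1 := harmonic_le_one_add_log (n + 1)
  have h2 := Real.log_le_rpow_div (x := ((n + 1 : ℕ) : ℝ)) (by positivity) hε
  have h3 : ((n + 1 : ℕ) : ℝ) ^ ε ≤ 2 ^ ε * (n : ℝ) ^ ε := by
    rw [← Real.mul_rpow zero_le_two n.cast_nonneg]
    gcongr; push_cast; linarith
  have h4 : 1 ≤ (n : ℝ) ^ ε := Real.one_le_rpow hn' hε.le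
  have h5 : ((n + 1 : ℕ) : ℝ) ^ ε / ε ≤ 2 ^ ε * (n : ℝ) ^ ε / ε := by gcongr
  calc 2 * (harmonic (n + 1) : ℝ) ≤ 2 * ((n : ℝ) ^ ε + 2 ^ ε * (n : ℝ) ^ ε / ε) := by linarith
    _ = _ := by ring

theorem Int.card_divisorsAntidiag_le (z : ℤ) :
    z.divisorsAntidiag.card ≤ 2 * z.natAbs.divisors.card := by
  calc z.divisorsAntidiag.card
      ≤ (z.natAbs.divisors ×ˢ ({1, -1} : Finset ℤ)).card := by
        refine Finset.card_le_card_of_injOn (fun x ↦ (x.1.natAbs, x.1.sign)) ?_ ?_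
        · rintro ⟨a, b⟩ h
          obtain ⟨rfl, h0⟩ := Int.mem_divisorsAntidiag.1 h
          have ha : a ≠ 0 := left_ne_zero_of_mul h0
          simp [Int.natAbs_mul, ha, ha.symm, right_ne_zero_of_mul h0]
        · rintro ⟨a, b⟩ h ⟨c, d⟩ h' heq
          obtain ⟨h1, h0⟩ := Int.mem_divisorsAntidiag.1 h
          obtain ⟨h2, -⟩ := Int.mem_divisorsAntidiag.1 h'
          have hac : a = c := by
            rw [← Int.sign_mul_natAbs a, ← Int.sign_mul_natAbs c]
            simp only [Prod.mk.injEq] at heq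
            rw [heq.1, heq.2]
          subst hac
          have ha : a ≠ 0 := by rintro rfl; simp at h1; exact h0 h1.symm
          simpa using mul_left_cancel₀ ha (h1.trans h2.symm)
    _ = _ := by rw [Finset.card_product]; simp [mul_comm]

/-- The triples `(a, b, c)` with `|a| ≤ q`, `|2ja + qb| ≤ 2q` and `|3j²a + 3qjb + q²c| ≤ q`; for
`0 ≤ j < q` the ranges imposed on `b` and `c` follow from these, see `mem_parabolicBox`. -/
noncomputable def parabolicBox (q j : ℤ) : Finset (ℤ × ℤ × ℤ) :=
  {t ∈ Finset.Icc (-q) q ×ˢ Finset.Icc (-(4 * q)) (4 * q) ×ˢ Finset.Icc (-(16 * q)) (16 * q) |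
    |2 * j * t.1 + q * t.2.1| ≤ 2 * q ∧
      |3 * j ^ 2 * t.1 + 3 * q * j * t.2.1 + q ^ 2 * t.2.2| ≤ q}

theorem abs_snd_le_of_parabolic {q j a b : ℤ} (hq : 1 ≤ q) (hj : j ∈ Finset.Icc 0 (q - 1))
    (hb : |2 * j * a + q * b| ≤ 2 * q) : |b| ≤ 2 + 2 * |a| := by
  rw [Finset.mem_Icc] at hj
  have h : q * |b| ≤ q * (2 + 2 * |a|) := by
    calc q * |b| = |(2 * j * a + q * b) + -(2 * j * a)| := by
          rw [← abs_of_nonneg (by omega : 0 ≤ q), ← abs_mul, abs_of_nonneg (by omega : 0 ≤ q)]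
          congr 1; ring
      _ ≤ |2 * j * a + q * b| + |-(2 * j * a)| := abs_add_le _ _
      _ = |2 * j * a + q * b| + 2 * j * |a| := by
          rw [abs_neg, abs_mul, abs_of_nonneg (by omega : 0 ≤ 2 * j)]
      _ ≤ 2 * q + 2 * q * |a| := by gcongr; omega
      _ = _ := by ring
  exact le_of_mul_le_mul_left h (by omega)

theorem abs_thd_le_of_parabolic {q j a b c : ℤ} (hq : 1 ≤ q) (hj : j ∈ Finset.Icc 0 (q - 1))
    (ha : |a| ≤ q) (hb : |2 * j * a + q * b| ≤ 2 * q)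
    (hc : |3 * j ^ 2 * a + 3 * q * j * b + q ^ 2 * c| ≤ q) : |c| ≤ 16 * q := by
  have hb' : |b| ≤ 4 * q := by have := abs_snd_le_of_parabolic hq hj hb; omega
  rw [Finset.mem_Icc] at hj
  have hj' : j ≤ q := by omega
  have h : q ^ 2 * |c| ≤ q ^ 2 * (16 * q) := by
    calc q ^ 2 * |c| = |(3 * j ^ 2 * a + 3 * q * j * b + q ^ 2 * c) +
            (-(3 * j ^ 2 * a) + -(3 * q * j * b))| := by
          rw [← abs_of_nonneg (sq_nonneg q), ← abs_mul, abs_of_nonneg (sq_nonneg q)]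
          congr 1; ring
      _ ≤ |3 * j ^ 2 * a + 3 * q * j * b + q ^ 2 * c| +
          (|-(3 * j ^ 2 * a)| + |-(3 * q * j * b)|) :=
          (abs_add_le _ _).trans (by gcongr; exact abs_add_le _ _)
      _ = |3 * j ^ 2 * a + 3 * q * j * b + q ^ 2 * c| + (3 * j ^ 2 * |a| + 3 * q * j * |b|) := by
          rw [abs_neg, abs_neg, abs_mul, abs_mul (3 * q * j),
            abs_of_nonneg (by positivity : 0 ≤ 3 * j ^ 2),
            abs_of_nonneg (by have := hj.1; positivity : 0 ≤ 3 * q * j)]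
      _ ≤ q + (3 * q ^ 2 * q + 3 * q * q * (4 * q)) := by
          have := hj.1
          gcongr
      _ ≤ q ^ 2 * (16 * q) := by nlinarith [mul_pos (by omega : 0 < q) (by omega : 0 < q)]
  exact le_of_mul_le_mul_left h (by positivity)

theorem abs_disc_le_of_parabolic {q j a b c : ℤ} (hq : 1 ≤ q) (ha : |a| ≤ q)
    (hb : |2 * j * a + q * b| ≤ 2 * q)
    (hc : |3 * j ^ 2 * a + 3 * q * j * b + q ^ 2 * c| ≤ q) : |3 * b ^ 2 - 4 * (a * c)| ≤ 16 := by
  have h : q ^ 2 * |3 * b ^ 2 - 4 * (a * c)| ≤ q ^ 2 * 16 := by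
    calc q ^ 2 * |3 * b ^ 2 - 4 * (a * c)| = |3 * (2 * j * a + q * b) ^ 2 +
            -(4 * (a * (3 * j ^ 2 * a + 3 * q * j * b + q ^ 2 * c)))| := by
          rw [← abs_of_nonneg (sq_nonneg q), ← abs_mul, abs_of_nonneg (sq_nonneg q)]
          congr 1; ring
      _ ≤ 3 * |2 * j * a + q * b| ^ 2 +
          4 * (|a| * |3 * j ^ 2 * a + 3 * q * j * b + q ^ 2 * c|) := by
          refine (abs_add_le _ _).trans (le_of_eq ?_)
          rw [abs_neg, abs_mul, abs_mul, abs_mul, abs_pow]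
          rfl
      _ ≤ 3 * (2 * q) ^ 2 + 4 * (q * q) := by gcongr
      _ = _ := by ring
  exact le_of_mul_le_mul_left h (by positivity)

theorem mem_parabolicBox {q j a b c : ℤ} (hq : 1 ≤ q) (hj : j ∈ Finset.Icc 0 (q - 1)) :
    (a, b, c) ∈ parabolicBox q j ↔ |a| ≤ q ∧ |2 * j * a + q * b| ≤ 2 * q ∧
      |3 * j ^ 2 * a + 3 * q * j * b + q ^ 2 * c| ≤ q := by
  simp only [parabolicBox, Finset.mem_filter, Finset.mem_product, Finset.mem_Icc, ← abs_le]
  refine ⟨fun h ↦ ⟨h.1.1, h.2⟩, fun h ↦ ⟨⟨h.1, ?_, ?_⟩, h.2⟩⟩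
  · have := abs_snd_le_of_parabolic hq hj h.2.1
    omega
  · exact abs_thd_le_of_parabolic hq hj h.1 h.2.1 h.2.2

theorem card_filter_abs_affine_le {q a b : ℤ} (ha : a ≠ 0) (haq : |a| ≤ q) :
    (({j ∈ Finset.Icc 0 (q - 1) | |2 * j * a + q * b| ≤ 2 * q}.card : ℕ) : ℝ) ≤
      3 * q / |(a : ℝ)| := by
  set J := {j ∈ Finset.Icc 0 (q - 1) | |2 * j * a + q * b| ≤ 2 * q}
  have ha' : 0 < |a| := abs_pos.2 ha
  rw [le_div_iff₀ (by exact_mod_cast ha')]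
  suffices h : (J.card : ℤ) * |a| ≤ 3 * q by exact_mod_cast h
  rcases J.eq_empty_or_nonempty with h | h
  · rw [h]; simp; omega
  have hsub : J ⊆ Finset.Icc (J.min' h) (J.min' h + 2 * q / |a|) := fun j hj ↦ by
    rw [Finset.mem_Icc]
    refine ⟨J.min'_le j hj, ?_⟩
    have h1 := (Finset.mem_filter.1 hj).2
    have h2 := (Finset.mem_filter.1 (J.min'_mem h)).2
    have h3 : 0 ≤ j - J.min' h := sub_nonneg.2 (J.min'_le j hj)
    suffices j - J.min' h ≤ 2 * q / |a| by omega
    rw [Int.le_ediv_iff_mul_le ha', ← abs_of_nonneg h3, ← abs_mul]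
    rw [abs_le] at *
    constructor <;> linarith
  have hcard := Finset.card_le_card hsub
  rw [Int.card_Icc] at hcard
  have h0 : 0 ≤ 2 * q / |a| := Int.ediv_nonneg (by omega) ha'.le
  have h1 : (J.card : ℤ) ≤ 2 * q / |a| + 1 := by omega
  have h2 := Int.ediv_mul_le (2 * q) ha'.ne'
  nlinarith

theorem card_divisorsAntidiag_fiber_le {C ε : ℝ} (hε : 0 < ε) (hC : 0 < C)
    (hdiv : ∀ n : ℕ, n ≠ 0 → (n.divisors.card : ℝ) ≤ C * (n : ℝ) ^ ε) {q b : ℤ} (hq : 1 ≤ q)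
    (hb : |b| ≤ 4 * q) :
    ((∑ m ∈ Finset.Icc ((3 * b ^ 2 - 16) / 4) ((3 * b ^ 2 + 16) / 4),
      m.divisorsAntidiag.card : ℕ) : ℝ) ≤ 18 * (C * (16 * (q : ℝ) ^ 2) ^ ε) := by
  have hcard : (Finset.Icc ((3 * b ^ 2 - 16) / 4) ((3 * b ^ 2 + 16) / 4)).card = 9 := by
    rw [Int.card_Icc]; omega
  have hb2 : b ^ 2 ≤ 16 * q ^ 2 := by
    have := sq_le_sq' (by linarith [abs_nonneg b]) hb
    rw [sq_abs] at this; linarith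
  have hq2 : 1 ≤ q ^ 2 := by nlinarith
  have hbound : ∀ m ∈ Finset.Icc ((3 * b ^ 2 - 16) / 4) ((3 * b ^ 2 + 16) / 4),
      (m.divisorsAntidiag.card : ℝ) ≤ 2 * (C * (16 * (q : ℝ) ^ 2) ^ ε) := fun m hm ↦ by
    rw [Finset.mem_Icc] at hm
    rcases eq_or_ne m 0 with rfl | h0
    · simp; positivity
    have hm2 : |m| ≤ 16 * q ^ 2 := by
      rw [abs_le]; have := sq_nonneg b; omega
    have hm3 : (m.natAbs : ℝ) ≤ 16 * (q : ℝ) ^ 2 := by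
      rw [Nat.cast_natAbs]; exact_mod_cast hm2
    calc (m.divisorsAntidiag.card : ℝ) ≤ 2 * (m.natAbs.divisors.card : ℝ) := by
          exact_mod_cast m.card_divisorsAntidiag_le
      _ ≤ 2 * (C * (m.natAbs : ℝ) ^ ε) := by gcongr; exact hdiv _ (by simpa using h0)
      _ ≤ _ := by gcongr
  push_cast
  refine (Finset.sum_le_card_nsmul _ _ _ hbound).trans (le_of_eq ?_)
  rw [hcard, nsmul_eq_mul]; push_cast; ring

/-- The triples `(a, b, 0)` with `a ≠ 0` that can occur in some `parabolicBox q j`. -/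
noncomputable def degenerateTriples (q : ℤ) : Finset (ℤ × ℤ × ℤ) :=
  (Finset.Icc (-q) q).erase 0 ×ˢ Finset.Icc (-2) 2 ×ˢ {0}

/-- A set containing the triples `(a, b, c)` with `a c ≠ 0` that occur in some `parabolicBox q j`. -/
noncomputable def nondegenerateTriples (q : ℤ) : Finset (ℤ × ℤ × ℤ) :=
  {t ∈ Finset.Icc (-q) q ×ˢ Finset.Icc (-(4 * q)) (4 * q) ×ˢ Finset.Icc (-(16 * q)) (16 * q) |
    t.1 ≠ 0 ∧ t.2.2 ≠ 0 ∧ |t.2.1| ≤ 2 + 2 * |t.1| ∧ |3 * t.2.1 ^ 2 - 4 * (t.1 * t.2.2)| ≤ 16}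

theorem parabolicBox_subset {q j : ℤ} (hq : 1 ≤ q) (hj : j ∈ Finset.Icc 0 (q - 1)) :
    parabolicBox q j ⊆ ({0} ×ˢ Finset.Icc (-2) 2 ×ˢ Finset.Icc (-7) 7) ∪
      ({t ∈ degenerateTriples q | |2 * j * t.1 + q * t.2.1| ≤ 2 * q} ∪
        {t ∈ nondegenerateTriples q | |2 * j * t.1 + q * t.2.1| ≤ 2 * q}) := by
  rintro ⟨a, b, c⟩ h
  obtain ⟨ha, hb, hc⟩ := (mem_parabolicBox hq hj).1 h
  have hb' := abs_snd_le_of_parabolic hq hj hb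
  have hc' := abs_thd_le_of_parabolic hq hj ha hb hc
  have hd := abs_disc_le_of_parabolic hq ha hb hc
  rw [Finset.mem_union, Finset.mem_union]
  by_cases ha0 : a = 0
  · subst ha0
    left
    rw [abs_zero] at hb'
    have hb2 : |b| ≤ 2 := by omega
    simp only [Finset.mem_product, Finset.mem_singleton, Finset.mem_Icc, ← abs_le, true_and]
    refine ⟨hb2, ?_⟩
    rw [Finset.mem_Icc] at hj
    have h1 : q * |3 * j * b + q * c| ≤ q * 1 := by
      rw [← abs_of_nonneg (by omega : 0 ≤ q), ← abs_mul, abs_of_nonneg (by omega : 0 ≤ q)]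
      calc _ = |3 * j ^ 2 * 0 + 3 * q * j * b + q ^ 2 * c| := by congr 1; ring
        _ ≤ _ := by linarith
    have h2 := le_of_mul_le_mul_left h1 (by omega)
    have h3 : |3 * j * b| ≤ 6 * q := by
      rw [abs_mul, abs_of_nonneg (by omega : 0 ≤ 3 * j)]
      nlinarith [abs_nonneg b]
    have h4 : q * |c| ≤ q * 7 := by
      rw [← abs_of_nonneg (by omega : 0 ≤ q), ← abs_mul, abs_of_nonneg (by omega : 0 ≤ q)]
      rw [abs_le] at *
      constructor <;> linarith
    exact le_of_mul_le_mul_left h4 (by omega)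
  · right
    by_cases hc0 : c = 0
    · subst hc0
      left
      simp only [degenerateTriples, Finset.mem_filter, Finset.mem_product, Finset.mem_singleton,
        Finset.mem_Icc, Finset.mem_erase, ← abs_le, and_true]
      refine ⟨⟨⟨ha0, ha⟩, ?_⟩, hb⟩
      rw [mul_zero, mul_zero, sub_zero, abs_of_nonneg (by positivity)] at hd
      rw [abs_le]
      constructor <;> nlinarith
    · right
      simp only [nondegenerateTriples, Finset.mem_filter, Finset.mem_product, Finset.mem_Icc,
        ← abs_le]
      exact ⟨⟨⟨ha, by omega, hc'⟩, ha0, hc0, hb', hd⟩, hb⟩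

theorem sum_card_filter_degenerateTriples_le (n : ℕ) :
    ∑ t ∈ degenerateTriples n,
      (({j ∈ Finset.Icc (0 : ℤ) (n - 1) | |2 * j * t.1 + n * t.2.1| ≤ 2 * n}.card : ℕ) : ℝ) ≤
      30 * n * ∑ k ∈ Finset.Icc (-(n : ℤ)) n, (1 : ℝ) / (|(k : ℝ)| + 1) := by
  calc _ ≤ ∑ t ∈ degenerateTriples n, 6 * n * (1 / (|(t.1 : ℝ)| + 1)) := by
        refine Finset.sum_le_sum fun t ht ↦ ?_
        simp only [degenerateTriples, Finset.mem_product, Finset.mem_erase, Finset.mem_Icc,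
          ← abs_le] at ht
        refine (card_filter_abs_affine_le ht.1.1 ht.1.2).trans ?_
        have h1 : (1 : ℝ) ≤ |(t.1 : ℝ)| := by exact_mod_cast Int.one_le_abs ht.1.1
        rw [mul_one_div, div_le_div_iff₀ (by linarith) (by linarith)]
        push_cast
        nlinarith [n.cast_nonneg (α := ℝ)]
    _ = 30 * n * ∑ k ∈ (Finset.Icc (-(n : ℤ)) n).erase 0, (1 : ℝ) / (|(k : ℝ)| + 1) := by
        rw [degenerateTriples, Finset.sum_product, Finset.mul_sum]
        refine Finset.sum_congr rfl fun a _ ↦ ?_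
        have h5 : (Finset.Icc (-2 : ℤ) 2 ×ˢ ({0} : Finset ℤ)).card = 5 := by simp
        simp only [Finset.sum_const, h5, nsmul_eq_mul]
        push_cast
        ring
    _ ≤ _ := by
        gcongr
        exact Finset.erase_subset _ _

theorem card_filter_nondegenerateTriples_le (q b : ℤ) :
    {t ∈ nondegenerateTriples q | t.2.1 = b}.card ≤
      ∑ m ∈ Finset.Icc ((3 * b ^ 2 - 16) / 4) ((3 * b ^ 2 + 16) / 4),
        m.divisorsAntidiag.card := by
  refine le_trans (Finset.card_le_card_of_injOn (fun t ↦ (t.1, t.2.2)) ?_ ?_) Finset.card_biUnion_le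
  · rintro ⟨a, b', c⟩ h
    have hb : b' = b := (Finset.mem_filter.1 h).2
    have hmem := (Finset.mem_filter.1 (Finset.mem_filter.1 h).1).2
    have ha : a ≠ 0 := hmem.1
    have hc : c ≠ 0 := hmem.2.1
    have hdisc : |3 * b' ^ 2 - 4 * (a * c)| ≤ 16 := hmem.2.2.2
    rw [hb, abs_le] at hdisc
    refine Finset.mem_coe.2 (Finset.mem_biUnion.2 ⟨a * c, Finset.mem_Icc.2 ?_,
      Int.mem_divisorsAntidiag.2 ⟨rfl, mul_ne_zero ha hc⟩⟩)
    omega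
  · rintro ⟨a, b, c⟩ h ⟨a', b', c'⟩ h' heq
    have hb : b = b' := (Finset.mem_filter.1 h).2.trans (Finset.mem_filter.1 h').2.symm
    simp only [Prod.mk.injEq] at heq
    rw [hb, heq.1, heq.2]

theorem sum_card_filter_nondegenerateTriples_le {C ε : ℝ} (hε : 0 < ε) (hC : 0 < C)
    (hdiv : ∀ n : ℕ, n ≠ 0 → (n.divisors.card : ℝ) ≤ C * (n : ℝ) ^ ε) {n : ℕ} (hn : 1 ≤ n) :
    ∑ t ∈ nondegenerateTriples n,
      (({j ∈ Finset.Icc (0 : ℤ) (n - 1) | |2 * j * t.1 + n * t.2.1| ≤ 2 * n}.card : ℕ) : ℝ) ≤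
      270 * n * (C * (16 * (n : ℝ) ^ 2) ^ ε) *
        ∑ k ∈ Finset.Icc (-((4 * n : ℕ) : ℤ)) (4 * n : ℕ), (1 : ℝ) / (|(k : ℝ)| + 1) := by
  calc _ ≤ ∑ t ∈ nondegenerateTriples n, 15 * n * (1 / (|(t.2.1 : ℝ)| + 1)) := by
        refine Finset.sum_le_sum fun t ht ↦ ?_
        simp only [nondegenerateTriples, Finset.mem_filter, Finset.mem_product, Finset.mem_Icc,
          ← abs_le] at ht
        refine (card_filter_abs_affine_le ht.2.1 ht.1.1).trans ?_
        have h1 : (1 : ℝ) ≤ |(t.1 : ℝ)| := by exact_mod_cast Int.one_le_abs ht.2.1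
        have h2 : |(t.2.1 : ℝ)| ≤ 2 + 2 * |(t.1 : ℝ)| := by exact_mod_cast ht.2.2.2.1
        rw [mul_one_div, div_le_div_iff₀ (by linarith) (by positivity)]
        push_cast
        nlinarith [n.cast_nonneg (α := ℝ)]
    _ = ∑ b ∈ Finset.Icc (-((4 * n : ℕ) : ℤ)) (4 * n : ℕ),
        ∑ t ∈ nondegenerateTriples n with t.2.1 = b, 15 * n * (1 / (|(t.2.1 : ℝ)| + 1)) := by
        refine (Finset.sum_fiberwise_of_maps_to (fun t ht ↦ ?_) _).symm
        simp only [nondegenerateTriples, Finset.mem_filter, Finset.mem_product] at ht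
        exact_mod_cast ht.1.2.1
    _ = ∑ b ∈ Finset.Icc (-((4 * n : ℕ) : ℤ)) (4 * n : ℕ),
        ({t ∈ nondegenerateTriples n | t.2.1 = b}.card : ℝ) * (15 * n * (1 / (|(b : ℝ)| + 1))) := by
        refine Finset.sum_congr rfl fun b _ ↦ ?_
        rw [← nsmul_eq_mul, ← Finset.sum_const]
        exact Finset.sum_congr rfl fun t ht ↦ by rw [(Finset.mem_filter.1 ht).2]
    _ ≤ ∑ b ∈ Finset.Icc (-((4 * n : ℕ) : ℤ)) (4 * n : ℕ),
        (18 * (C * (16 * (n : ℝ) ^ 2) ^ ε)) * (15 * n * (1 / (|(b : ℝ)| + 1))) := by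
        refine Finset.sum_le_sum fun b hb ↦ ?_
        gcongr
        rw [Finset.mem_Icc, ← abs_le] at hb
        have h := card_divisorsAntidiag_fiber_le hε hC hdiv (q := n) (b := b) (by exact_mod_cast hn)
          (by exact_mod_cast hb)
        exact (Nat.cast_le.2 (card_filter_nondegenerateTriples_le n b)).trans
          (by exact_mod_cast h)
    _ = _ := by
        rw [Finset.mul_sum]
        exact Finset.sum_congr rfl fun b _ ↦ by ring

theorem sum_card_parabolicBox_le {ε : ℝ} (hε : 0 < ε) :
    ∃ C : ℝ, 0 < C ∧ ∀ q : ℤ, 1 ≤ q →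
      ∑ j ∈ Finset.Icc 0 (q - 1), ((parabolicBox q j).card : ℝ) ≤ C * q * (q : ℝ) ^ ε := by
  obtain ⟨A, hA, hdiv⟩ := card_divisors_le_mul_rpow (by positivity : 0 < ε / 4)
  obtain ⟨B, hB, hsum⟩ := sum_Icc_inv_abs_add_one_le_mul_rpow (by positivity : 0 < ε / 2)
  refine ⟨75 + 30 * B + 270 * (A * 16 ^ (ε / 4)) * (B * 4 ^ (ε / 2)), by positivity,
    fun q hq ↦ ?_⟩
  lift q to ℕ using by omega
  have hq' : 1 ≤ q := by exact_mod_cast hq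
  have hqR : (1 : ℝ) ≤ q := by exact_mod_cast hq'
  have hswap (T : Finset (ℤ × ℤ × ℤ)) : ∑ j ∈ Finset.Icc (0 : ℤ) (q - 1),
      (({t ∈ T | |2 * j * t.1 + q * t.2.1| ≤ 2 * q}.card : ℕ) : ℝ) =
      ∑ t ∈ T,
        (({j ∈ Finset.Icc (0 : ℤ) (q - 1) | |2 * j * t.1 + q * t.2.1| ≤ 2 * q}.card : ℕ) : ℝ) := by
    exact_mod_cast Finset.sum_card_bipartiteAbove_eq_sum_card_bipartiteBelow
      (fun (j : ℤ) (t : ℤ × ℤ × ℤ) ↦ |2 * j * t.1 + q * t.2.1| ≤ 2 * q)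
  have h1 := sum_card_filter_degenerateTriples_le q
  have h2 := sum_card_filter_nondegenerateTriples_le (by positivity) hA hdiv hq'
  have hs1 := hsum q hq'
  have hs2 := hsum (4 * q) (by omega)
  have hp1 : (16 * (q : ℝ) ^ 2) ^ (ε / 4) = 16 ^ (ε / 4) * (q : ℝ) ^ (ε / 2) := by
    rw [Real.mul_rpow (by norm_num) (by positivity), ← Real.rpow_natCast,
      ← Real.rpow_mul (by positivity)]
    congr 2; push_cast; ring
  have hp2 : ((4 * q : ℕ) : ℝ) ^ (ε / 2) = 4 ^ (ε / 2) * (q : ℝ) ^ (ε / 2) := by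
    push_cast; rw [Real.mul_rpow (by norm_num) (by positivity)]
  have hp3 : (q : ℝ) ^ ε = (q : ℝ) ^ (ε / 2) * (q : ℝ) ^ (ε / 2) := by
    rw [← Real.rpow_add (by positivity)]; congr 1; ring
  have hone : 1 ≤ (q : ℝ) ^ (ε / 2) := Real.one_le_rpow hqR (by positivity)
  rw [hp2] at hs2
  rw [hp1] at h2
  push_cast
  rw [hp3]
  set Q := (q : ℝ) ^ (ε / 2)
  calc ∑ j ∈ Finset.Icc (0 : ℤ) (q - 1), ((parabolicBox q j).card : ℝ)
      ≤ ∑ j ∈ Finset.Icc (0 : ℤ) (q - 1), ((75 : ℝ) +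
        ((({t ∈ degenerateTriples q | |2 * j * t.1 + q * t.2.1| ≤ 2 * q}.card : ℕ) : ℝ) +
        (({t ∈ nondegenerateTriples q | |2 * j * t.1 + q * t.2.1| ≤ 2 * q}.card : ℕ) : ℝ))) := by
        refine Finset.sum_le_sum fun j hj ↦ ?_
        have h := (Finset.card_le_card (parabolicBox_subset hq hj)).trans
          ((Finset.card_union_le _ _).trans (Nat.add_le_add_left (Finset.card_union_le _ _) _))
        have h75 : (({0} : Finset ℤ) ×ˢ Finset.Icc (-2 : ℤ) 2 ×ˢ Finset.Icc (-7 : ℤ) 7).card = 75 := by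
          simp
        rw [h75] at h
        exact_mod_cast h
    _ ≤ 75 * q + (30 * q * (B * Q) +
        270 * q * (A * (16 ^ (ε / 4) * Q)) * (B * (4 ^ (ε / 2) * Q))) := by
        rw [Finset.sum_add_distrib, Finset.sum_add_distrib, hswap, hswap, Finset.sum_const,
          Int.card_Icc, nsmul_eq_mul]
        refine add_le_add (by simp [mul_comm]) (add_le_add (h1.trans ?_) (h2.trans ?_)) <;> gcongr
    _ ≤ 75 * q * (Q * Q) + (30 * q * (B * (Q * Q)) +
        270 * q * (A * (16 ^ (ε / 4) * Q)) * (B * (4 ^ (ε / 2) * Q))) := by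
        have hQ : Q ≤ Q * Q := le_mul_of_one_le_right (by positivity) hone
        have hq75 : 75 * (q : ℝ) ≤ 75 * q * (Q * Q) :=
          le_mul_of_one_le_right (by positivity) (hone.trans hQ)
        gcongr
    _ = _ := by ring

theorem exists_parametrization {q u v : ℤ} (hq : 1 ≤ q) (h : v ^ 2 ≡ u ^ 3 [ZMOD q ^ 4])
    (hc : Int.gcd (u * v) q = 1) :
    ∃ r k l : ℤ, 0 ≤ r ∧ r < q ^ 2 ∧ u = r ^ 2 + q ^ 2 * k ∧
      2 * v = 3 * u * r - r ^ 3 + q ^ 4 * l := by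
  have hcop : IsCoprime u (q ^ 4) :=
    (IsCoprime.of_mul_left_left (Int.isCoprime_iff_gcd_eq_one.2 hc)).pow_right
  obtain ⟨a, b, hab⟩ := hcop
  obtain ⟨m, hm⟩ : q ^ 4 ∣ (a * v) ^ 2 - u := by
    obtain ⟨c, hc⟩ := h.dvd
    exact ⟨-(b * (a * u ^ 2 + u)) - a ^ 2 * c, by
      linear_combination (a * u ^ 2 + u) * hab - a ^ 2 * hc⟩
  have ht := Int.emod_add_mul_ediv (a * v) (q ^ 2)
  have hq2 : 0 < q ^ 2 := by positivity
  set r := a * v % q ^ 2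
  set s := a * v / q ^ 2
  refine ⟨r, 2 * r * s + q ^ 2 * s ^ 2 - q ^ 2 * m,
    m * (a * v) - 3 * q ^ 2 * s * m + 3 * (a * v) * s ^ 2 - q ^ 2 * s ^ 3 + 2 * b * v,
    Int.emod_nonneg _ hq2.ne', Int.emod_lt_of_pos _ hq2, ?_, ?_⟩
  · rw [← ht] at hm
    linear_combination -hm
  · have hr : r = a * v - q ^ 2 * s := by linarith
    have hu : u = (a * v) ^ 2 - q ^ 4 * m := by linarith
    rw [hr]
    linear_combination (-2 * v) * hab + (-(a * v) + 3 * q ^ 2 * s) * hu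

theorem abs_sub_le_of_ediv_eq {a b n : ℤ} (hn : 0 < n) (h : a / n = b / n) : |a - b| ≤ n := by
  have h1 := Int.emod_add_mul_ediv a n
  have h2 := Int.emod_add_mul_ediv b n
  have := Int.emod_nonneg a hn.ne'
  have := Int.emod_nonneg b hn.ne'
  have := Int.emod_lt_of_pos a hn
  have := Int.emod_lt_of_pos b hn
  rw [h] at h1
  rw [abs_le]
  constructor <;> linarith

theorem card_le_card_parabolicBox {q i h j : ℤ} (hq : 1 ≤ q) (hj : j ∈ Finset.Icc 0 (q - 1))
    (F : Finset (ℤ × ℤ)) (a b c : ℤ × ℤ → ℤ)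
    (ha : ∀ x ∈ F, 0 ≤ a x ∧ a x < q)
    (hu : ∀ x ∈ F, x.1 = (q * j + a x) ^ 2 + q ^ 2 * b x)
    (hv : ∀ x ∈ F, 2 * x.2 = 3 * x.1 * (q * j + a x) - (q * j + a x) ^ 3 + q ^ 4 * c x)
    (hi : ∀ x ∈ F, x.1 / q ^ 2 = i)
    (hh : ∀ x ∈ F, (2 * x.2 - 3 * a x * x.1 + a x ^ 3) / q ^ 3 = h) :
    F.card ≤ (parabolicBox q j).card := by
  rcases F.eq_empty_or_nonempty with rfl | ⟨y, hy⟩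
  · simp
  refine Finset.card_le_card_of_injOn (fun x ↦ (a x - a y, b x - b y, c x - c y)) ?_ ?_
  · intro x hx
    rw [Finset.mem_coe] at hx ⊢
    obtain ⟨hax, hax'⟩ := ha x hx
    obtain ⟨hay, hay'⟩ := ha y hy
    refine (mem_parabolicBox hq hj).2 ⟨by rw [abs_le]; constructor <;> linarith, ?_, ?_⟩
    · have h1 := abs_sub_le_of_ediv_eq (by positivity) ((hi x hx).trans (hi y hy).symm)
      have h2 : |q * (2 * j * (a x - a y) + q * (b x - b y))| ≤ q * (2 * q) := by
        have h3 : q * (2 * j * (a x - a y) + q * (b x - b y)) =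
            (x.1 - y.1) - (a x ^ 2 - a y ^ 2) := by
          rw [hu x hx, hu y hy]; ring
        have h4 : |a x ^ 2 - a y ^ 2| ≤ q ^ 2 := by
          rw [abs_le]; constructor <;> nlinarith
        rw [h3]
        exact (abs_sub _ _).trans (by linarith)
      rw [abs_mul, abs_of_nonneg (by omega : 0 ≤ q)] at h2
      exact le_of_mul_le_mul_left h2 (by omega)
    · have h1 := abs_sub_le_of_ediv_eq (by positivity) ((hh x hx).trans (hh y hy).symm)
      have h2 : q ^ 2 * (3 * j ^ 2 * (a x - a y) + 3 * q * j * (b x - b y) +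
          q ^ 2 * (c x - c y)) = (2 * x.2 - 3 * a x * x.1 + a x ^ 3) -
            (2 * y.2 - 3 * a y * y.1 + a y ^ 3) := by
        rw [hv x hx, hv y hy, hu x hx, hu y hy]; ring
      rw [← h2, abs_mul, abs_of_nonneg (by positivity)] at h1
      exact le_of_mul_le_mul_left (h1.trans (by linarith [pow_succ q 2])) (by positivity : 0 < q ^ 2)
  · intro x hx y' hy' heq
    simp only [Prod.mk.injEq, sub_left_inj] at heq
    obtain ⟨h1, h2, h3⟩ := heq
    have hx1 : x.1 = y'.1 := by rw [hu x hx, hu y' hy', h1, h2]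
    have hx2 : 2 * x.2 = 2 * y'.2 := by rw [hv x hx, hv y' hy', h1, h3, hx1]
    exact Prod.ext hx1 (by omega)

theorem card_solutions_le {q A B : ℤ} (hq : 1 ≤ q) (S : Finset (ℤ × ℤ))
    (hS : ∀ x ∈ S, x.2 ^ 2 ≡ x.1 ^ 3 [ZMOD q ^ 4] ∧ |x.1| ≤ A ∧ |x.2| ≤ B ∧
      Int.gcd (x.1 * x.2) q = 1) :
    S.card ≤ (Finset.Icc (-A / q ^ 2) (A / q ^ 2)).card *
      ((Finset.Icc (-(2 * B + 3 * q * A + q ^ 3) / q ^ 3)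
        ((2 * B + 3 * q * A + q ^ 3) / q ^ 3)).card *
        ∑ j ∈ Finset.Icc 0 (q - 1), (parabolicBox q j).card) := by
  set Y := 2 * B + 3 * q * A + q ^ 3 with hY
  have hpar (x : ℤ × ℤ) : ∃ r k l : ℤ, x ∈ S → 0 ≤ r ∧ r < q ^ 2 ∧ x.1 = r ^ 2 + q ^ 2 * k ∧
      2 * x.2 = 3 * x.1 * r - r ^ 3 + q ^ 4 * l := by
    by_cases hx : x ∈ S
    · obtain ⟨r, k, l, h⟩ := exists_parametrization hq (hS x hx).1 (hS x hx).2.2.2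
      exact ⟨r, k, l, fun _ ↦ h⟩
    · exact ⟨0, 0, 0, fun h ↦ absurd h hx⟩
  choose r k l hrkl using hpar
  have hq0 : 0 < q := by omega
  have hmod (x : ℤ × ℤ) : 0 ≤ r x % q ∧ r x % q < q :=
    ⟨Int.emod_nonneg _ hq0.ne', Int.emod_lt_of_pos _ hq0⟩
  let cell (x : ℤ × ℤ) : ℤ × ℤ × ℤ := (x.1 / q ^ 2,
    (2 * x.2 - 3 * (r x % q) * x.1 + (r x % q) ^ 3) / q ^ 3, r x / q)
  have hmaps : ∀ x ∈ S, cell x ∈ Finset.Icc (-A / q ^ 2) (A / q ^ 2) ×ˢ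
      Finset.Icc (-Y / q ^ 3) (Y / q ^ 3) ×ˢ Finset.Icc 0 (q - 1) := fun x hx ↦ by
    obtain ⟨-, hA, hB, -⟩ := hS x hx
    obtain ⟨hr0, hr1, -, -⟩ := hrkl x hx
    obtain ⟨hm0, hm1⟩ := hmod x
    have hYx : |2 * x.2 - 3 * (r x % q) * x.1 + (r x % q) ^ 3| ≤ Y := by
      calc _ ≤ |2 * x.2 - 3 * (r x % q) * x.1| + |(r x % q) ^ 3| := abs_add_le _ _
        _ ≤ |2 * x.2| + |3 * (r x % q) * x.1| + |(r x % q) ^ 3| := by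
          gcongr; exact abs_sub _ _
        _ = 2 * |x.2| + 3 * (r x % q) * |x.1| + (r x % q) ^ 3 := by
          rw [abs_mul, abs_mul _ x.1, abs_of_nonneg (by positivity : 0 ≤ (r x % q) ^ 3),
            abs_of_nonneg (by positivity : 0 ≤ 3 * (r x % q))]
          rfl
        _ ≤ Y := by rw [hY]; gcongr
    rw [abs_le] at hA hYx
    simp only [cell, Finset.mem_product, Finset.mem_Icc]
    refine ⟨⟨Int.ediv_le_ediv (by positivity) hA.1, Int.ediv_le_ediv (by positivity) hA.2⟩,
      ⟨Int.ediv_le_ediv (by positivity) hYx.1, Int.ediv_le_ediv (by positivity) hYx.2⟩,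
      Int.ediv_nonneg hr0 hq0.le, ?_⟩
    have : r x / q < q := Int.ediv_lt_of_lt_mul hq0 (by linarith [sq q])
    omega
  calc S.card = ∑ t ∈ Finset.Icc (-A / q ^ 2) (A / q ^ 2) ×ˢ
        Finset.Icc (-Y / q ^ 3) (Y / q ^ 3) ×ˢ Finset.Icc 0 (q - 1), {x ∈ S | cell x = t}.card :=
        Finset.card_eq_sum_card_fiberwise hmaps
    _ ≤ ∑ t ∈ Finset.Icc (-A / q ^ 2) (A / q ^ 2) ×ˢ
        Finset.Icc (-Y / q ^ 3) (Y / q ^ 3) ×ˢ Finset.Icc 0 (q - 1),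
        (parabolicBox q t.2.2).card := by
        refine Finset.sum_le_sum fun t ht ↦ ?_
        simp only [Finset.mem_product] at ht
        have hcell : ∀ x ∈ {x ∈ S | cell x = t}, x ∈ S ∧ cell x = t :=
          fun x hx ↦ Finset.mem_filter.1 hx
        have hr : ∀ x ∈ {x ∈ S | cell x = t}, q * t.2.2 + r x % q = r x := fun x hx ↦ by
          rw [← (hcell x hx).2]; exact Int.mul_ediv_add_emod _ _
        refine card_le_card_parabolicBox hq ht.2.2 _ (fun x ↦ r x % q) k l
          (fun x _ ↦ hmod x) (fun x hx ↦ ?_) (fun x hx ↦ ?_) (i := t.1) (h := t.2.1)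
          (fun x hx ↦ ?_) (fun x hx ↦ ?_)
        · rw [hr x hx]; exact (hrkl x (hcell x hx).1).2.2.1
        · rw [hr x hx]; exact (hrkl x (hcell x hx).1).2.2.2
        · rw [← (hcell x hx).2]
        · rw [← (hcell x hx).2]
    _ = _ := by
        simp only [Finset.sum_product, Finset.sum_const, smul_eq_mul]

theorem card_Icc_ediv_le {A n : ℤ} {X : ℝ} (hn : 0 < n) (hX : 0 ≤ X) (hA : (A : ℝ) ≤ X) :
    ((Finset.Icc (-A / n) (A / n)).card : ℝ) ≤ 2 * X / n + 2 := by
  have hn' : (0 : ℝ) < n := by exact_mod_cast hn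
  rw [Int.card_Icc]
  have h1 : ((A / n : ℤ) : ℝ) ≤ X / n := by
    rw [le_div_iff₀ hn']
    exact le_trans (by exact_mod_cast Int.ediv_mul_le A hn.ne') hA
  have h2 : -(X / n) - 1 ≤ ((-A / n : ℤ) : ℝ) := by
    have h3 := Int.lt_ediv_add_one_mul_self (-A) hn
    have h4 : -(A : ℝ) < (((-A / n : ℤ) : ℝ) + 1) * n := by exact_mod_cast h3
    have h5 : -(X / n) ≤ ((-A / n : ℤ) : ℝ) + 1 := by
      rw [← neg_div, div_le_iff₀ hn']; linarith
    linarith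
  have h3 : (((A / n + 1 - -A / n).toNat : ℤ) : ℝ) ≤ X / n + 1 + (X / n) + 1 := by
    rw [Int.toNat_eq_max]
    push_cast
    refine max_le (by linarith) (by positivity)
  calc _ = (((A / n + 1 - -A / n).toNat : ℤ) : ℝ) := by norm_cast
    _ ≤ _ := h3
    _ = _ := by ring

theorem Mcount_eq_card (U V : ℝ) (q : ℤ) :
    ∃ S : Finset (ℤ × ℤ), Mcount U V q = S.card ∧
      ∀ x ∈ S, x.2 ^ 2 ≡ x.1 ^ 3 [ZMOD q ^ 4] ∧ |x.1| ≤ ⌊U⌋ ∧ |x.2| ≤ ⌊V⌋ ∧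
        Int.gcd (x.1 * x.2) q = 1 := by
  have hfin : {t : ℤ × ℤ | t.2 ^ 2 ≡ t.1 ^ 3 [ZMOD q ^ 4] ∧
      (|t.1| : ℝ) ≤ U ∧ (|t.2| : ℝ) ≤ V ∧ Int.gcd (t.1 * t.2) q = 1}.Finite := by
    refine (Finset.Icc (-⌊U⌋) ⌊U⌋ ×ˢ Finset.Icc (-⌊V⌋) ⌊V⌋).finite_toSet.subset ?_
    rintro t ⟨-, h1, h2, -⟩
    have hu : |t.1| ≤ ⌊U⌋ := Int.le_floor.2 (by push_cast; exact h1)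
    have hv : |t.2| ≤ ⌊V⌋ := Int.le_floor.2 (by push_cast; exact h2)
    exact Finset.mem_coe.2 (Finset.mem_product.2
      ⟨Finset.mem_Icc.2 (abs_le.1 hu), Finset.mem_Icc.2 (abs_le.1 hv)⟩)
  refine ⟨hfin.toFinset, ?_, fun x hx ↦ ?_⟩
  · rw [← Set.ncard_eq_toFinset_card _ hfin]
    rfl
  · obtain ⟨h0, h1, h2, h3⟩ := (Set.Finite.mem_toFinset hfin).1 hx
    refine ⟨h0, Int.le_floor.2 ?_, Int.le_floor.2 ?_, h3⟩ <;> push_cast <;> assumption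

/-- If `q ≤ c₀ U^{1/2}` and `U ≤ c₀ V^{2/3}`, then `ℳ(U, V, q) ≪ V^ε U V / q⁴`. -/
theorem Mcount_bound_special (ε c₀ : ℝ) (hε : 0 < ε) (hc₀ : 0 < c₀) :
    ∃ C : ℝ, 0 < C ∧ ∀ U V : ℝ, 1 ≤ U → 1 ≤ V → ∀ q : ℤ, 1 ≤ q →
      (q : ℝ) ≤ c₀ * U ^ ((1 : ℝ) / 2) → U ≤ c₀ * V ^ ((2 : ℝ) / 3) →
      (Mcount U V q : ℝ) ≤ C * V ^ ε * (U * V / q ^ 4) := by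
  obtain ⟨D, hD, hbox⟩ := sum_card_parabolicBox_le hε
  set c₁ : ℝ := c₀ ^ ((1 : ℝ) / 2) with hc₁
  have hc₁0 : 0 < c₁ := by positivity
  set K : ℝ := 2 * (2 + 3 * (c₀ * (c₀ * c₁)) + c₀ ^ 3 * (c₀ * c₁)) + 2 * (c₀ ^ 3 * (c₀ * c₁)) with hK
  have hK0 : 0 < K := by positivity
  refine ⟨(2 + 2 * c₀ ^ 2) * K * (D * (c₀ * c₁) ^ ε), by positivity,
    fun U V hU hV q hq hqU hUV ↦ ?_⟩
  have hq0 : (1 : ℝ) ≤ q := by exact_mod_cast hq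
  set s := U ^ ((1 : ℝ) / 2) with hs
  set w := V ^ ((1 : ℝ) / 3) with hw
  have hs0 : 0 < s := by positivity
  have hw0 : 0 < w := by positivity
  have hsU : s ^ 2 = U := by
    rw [hs, ← Real.rpow_natCast, ← Real.rpow_mul (by positivity)]; norm_num
  have hwV : w ^ 3 = V := by
    rw [hw, ← Real.rpow_natCast, ← Real.rpow_mul (by positivity)]; norm_num
  have hw2 : V ^ ((2 : ℝ) / 3) = w ^ 2 := by
    rw [hw, ← Real.rpow_natCast, ← Real.rpow_mul (by positivity)]; norm_num
  have hc₁2 : c₁ ^ 2 = c₀ := by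
    rw [hc₁, ← Real.rpow_natCast, ← Real.rpow_mul (by positivity)]; norm_num
  have hsw : s ≤ c₁ * w := by
    refine le_of_sq_le_sq ?_ (by positivity)
    rw [mul_pow, hc₁2, hsU, ← hw2]; exact hUV
  have hs3 : s ^ 3 ≤ c₀ * c₁ * V := by
    calc s ^ 3 ≤ (c₁ * w) ^ 3 := by gcongr
      _ = c₀ * c₁ * V := by rw [← hwV, ← hc₁2]; ring
  have hqw : (q : ℝ) ≤ c₀ * c₁ * V := by
    have hw1 : 1 ≤ w := Real.one_le_rpow hV (by norm_num)
    calc (q : ℝ) ≤ c₀ * (c₁ * w) := hqU.trans (by gcongr)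
      _ ≤ c₀ * c₁ * V := by
        rw [← hwV, mul_assoc]; gcongr; exact le_self_pow₀ hw1 (by norm_num)
  have hq2 : (q : ℝ) ^ 2 ≤ c₀ ^ 2 * U := by
    rw [← hsU, ← mul_pow]; gcongr
  have hqUV : q * U ≤ c₀ * (c₀ * c₁) * V := by
    calc q * U ≤ c₀ * s * s ^ 2 := by rw [hsU]; gcongr
      _ = c₀ * s ^ 3 := by ring
      _ ≤ c₀ * (c₀ * c₁ * V) := by gcongr
      _ = _ := by ring
  have hq3 : (q : ℝ) ^ 3 ≤ c₀ ^ 3 * (c₀ * c₁) * V := by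
    calc (q : ℝ) ^ 3 ≤ (c₀ * s) ^ 3 := by gcongr
      _ = c₀ ^ 3 * s ^ 3 := by ring
      _ ≤ c₀ ^ 3 * (c₀ * c₁ * V) := by gcongr
      _ = _ := by ring
  obtain ⟨S, hcard, hS⟩ := Mcount_eq_card U V q
  have hI := card_Icc_ediv_le (n := q ^ 2) (by positivity) (by positivity) (Int.floor_le U)
  have hH := card_Icc_ediv_le (n := q ^ 3) (A := 2 * ⌊V⌋ + 3 * q * ⌊U⌋ + q ^ 3)
    (X := 2 * V + 3 * q * U + q ^ 3) (by positivity) (by positivity) (by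
      push_cast
      gcongr
      · exact Int.floor_le V
      · exact Int.floor_le U)
  have hI' : 2 * U / ((q ^ 2 : ℤ) : ℝ) + 2 ≤ (2 + 2 * c₀ ^ 2) * (U / q ^ 2) := by
    push_cast
    have : 1 ≤ c₀ ^ 2 * U / q ^ 2 := by rwa [one_le_div (by positivity)]
    calc _ ≤ 2 * U / (q : ℝ) ^ 2 + 2 * (c₀ ^ 2 * U / q ^ 2) := by linarith
      _ = _ := by ring
  have hH' : 2 * (2 * V + 3 * q * U + q ^ 3) / ((q ^ 3 : ℤ) : ℝ) + 2 ≤ K * (V / q ^ 3) := by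
    push_cast
    have h1 : 1 ≤ c₀ ^ 3 * (c₀ * c₁) * V / q ^ 3 := by rwa [one_le_div (by positivity)]
    calc _ ≤ 2 * (2 * V + 3 * (c₀ * (c₀ * c₁) * V) + c₀ ^ 3 * (c₀ * c₁) * V) / (q : ℝ) ^ 3 +
          2 * (c₀ ^ 3 * (c₀ * c₁) * V / q ^ 3) := by
          have h2 : 2 * V + 3 * q * U + (q : ℝ) ^ 3 ≤
            2 * V + 3 * (c₀ * (c₀ * c₁) * V) + c₀ ^ 3 * (c₀ * c₁) * V := by linarith
          refine add_le_add ?_ (by linarith)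
          gcongr
      _ = _ := by rw [hK]; ring
  have hB : ∑ j ∈ Finset.Icc 0 (q - 1), ((parabolicBox q j).card : ℝ) ≤
      D * (c₀ * c₁) ^ ε * V ^ ε * q := by
    calc _ ≤ D * q * (q : ℝ) ^ ε := hbox q hq
      _ ≤ D * q * (c₀ * c₁ * V) ^ ε := by gcongr
      _ = _ := by rw [Real.mul_rpow (by positivity) (by positivity)]; ring
  have hcells : (Mcount U V q : ℝ) ≤ _ :=
    (Nat.cast_le.2 (hcard.trans_le (card_solutions_le hq S hS)))
  refine hcells.trans ?_
  rw [← Nat.cast_sum] at hB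
  rw [Nat.cast_mul, Nat.cast_mul]
  calc _ ≤ (2 + 2 * c₀ ^ 2) * (U / q ^ 2) * (K * (V / q ^ 3) *
        (D * (c₀ * c₁) ^ ε * V ^ ε * q)) :=
        mul_le_mul (hI.trans hI') (mul_le_mul (hH.trans hH') hB (Nat.cast_nonneg _) (by positivity))
          (mul_nonneg (Nat.cast_nonneg _) (Nat.cast_nonneg _)) (by positivity)
    _ = _ := by field_simp
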